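/- For any positive integers n ≥ m, Σ_{k=−n}^{n} (−1)^k k^(2m) · π^(4n) / ((2n+2k+1)! · (2n−2k+1)!) = Σ_{j=1}^{m} 4^(n−j) · a_{2m,j} · ζ({2}^(2j) ⧢ {3,1}^(n−j)), where a_{2m,j} = Σ_{k=−j}^{j} (−1)^k k^(2m) binom(2j, j−k). -/

import Mathlib

/-- The multiple zeta value `ζ(s₁,…,s_d) = ∑_{k₁ > k₂ > ⋯ > k_d ≥ 1} 1/(k₁^{s₁} ⋯ k_d^{s_d})`. -/
noncomputable def mzv (s : List ℕ) : ℝ :=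
  ∑' k : {k : Fin s.length → ℕ // StrictAnti k ∧ ∀ i, 0 < k i},
    ∏ i, 1 / ((k.1 i : ℝ) ^ s.get i)

/-- The list of all shuffles (interleavings) of two lists, with multiplicity. -/
def listShuffles {α : Type*} : List α → List α → List (List α)
  | [], v => [v]
  | u, [] => [u]
  | a :: u, b :: v =>
      ((listShuffles u (b :: v)).map (a :: ·)) ++ ((listShuffles (a :: u) v).map (b :: ·))

/-- `ζ(u ⧢ v)`: the sum of `ζ(w)` over all shuffles `w` of `u` and `v`, with multiplicity. -/
noncomputable def zetaShuffle (u v : List ℕ) : ℝ :=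
  ((listShuffles u v).map mzv).sum

open PowerSeries in
/-- integration operator of depth one with exponent s -/
noncomputable def mzJ (s : ℕ) : PowerSeries ℝ →ₗ[ℝ] PowerSeries ℝ where
  toFun f := PowerSeries.mk fun n => (∑ k ∈ Finset.range n, coeff k f) / (n : ℝ) ^ s
  map_add' f g := by
    ext n; simp [Finset.sum_add_distrib, add_div]
  map_smul' c f := by
    ext n; simp [← Finset.mul_sum, mul_div_assoc]

open PowerSeries in
noncomputable def mzI : PowerSeries ℝ →ₗ[ℝ] PowerSeries ℝ where
  toFun f := PowerSeries.mk fun n => coeff n f / (n : ℝ)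
  map_add' f g := by
    ext n; simp [add_div]
  map_smul' c f := by
    ext n; simp [mul_div_assoc]

open PowerSeries in
lemma coeff_mzJ (s : ℕ) (f : PowerSeries ℝ) (n : ℕ) :
    coeff n (mzJ s f) = (∑ k ∈ Finset.range n, coeff k f) / (n : ℝ) ^ s := by
  simp [mzJ]

open PowerSeries in
lemma coeff_mzI (f : PowerSeries ℝ) (n : ℕ) :
    coeff n (mzI f) = coeff n f / (n : ℝ) := by
  simp [mzI]

lemma mzI_mzJ (s : ℕ) (f : PowerSeries ℝ) : mzI (mzJ s f) = mzJ (s + 1) f := by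
  ext n
  rw [coeff_mzI, coeff_mzJ, coeff_mzJ, div_div, pow_succ]

noncomputable abbrev mzD (f : PowerSeries ℝ) : PowerSeries ℝ := PowerSeries.derivative ℝ f

lemma X_mzD_mzI (f : PowerSeries ℝ) (h : PowerSeries.coeff 0 f = 0) :
    PowerSeries.X * mzD (mzI f) = f := by
  ext n
  cases n with
  | zero => simpa using h.symm
  | succ n =>
    rw [PowerSeries.coeff_succ_X_mul, PowerSeries.coeff_derivative, coeff_mzI]
    have : (n : ℝ) + 1 ≠ 0 := by positivity
    push_cast
    field_simp

lemma mzD_mzJ_one (f : PowerSeries ℝ) :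
    (1 - PowerSeries.X) * mzD (mzJ 1 f) = f := by
  ext n
  rw [sub_mul, one_mul, map_sub]
  cases n with
  | zero => simp [PowerSeries.coeff_derivative, coeff_mzJ]
  | succ n =>
    rw [PowerSeries.coeff_succ_X_mul, PowerSeries.coeff_derivative, PowerSeries.coeff_derivative,
      coeff_mzJ, coeff_mzJ, Finset.sum_range_succ]
    have : (n : ℝ) + 1 ≠ 0 := by positivity
    have : (n : ℝ) + 1 + 1 ≠ 0 := by positivity
    push_cast
    field_simp
    ring

lemma mz_one_sub_X_ne : (1 - PowerSeries.X : PowerSeries ℝ) ≠ 0 := by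
  intro h
  have := congrArg (PowerSeries.coeff 0) h
  simp at this

/-- uniqueness principle -/
lemma mz_unique (f g h : PowerSeries ℝ) (hf : PowerSeries.coeff 0 f = 0)
    (hh : PowerSeries.coeff 0 h = 0)
    (H : PowerSeries.X * (1 - PowerSeries.X) * mzD h
      = (1 - PowerSeries.X) * f + PowerSeries.X * g) :
    h = mzI f + mzJ 1 g := by
  apply PowerSeries.derivative.ext
  · have hX : (PowerSeries.X * (1 - PowerSeries.X) : PowerSeries ℝ) ≠ 0 :=
      mul_ne_zero PowerSeries.X_ne_zero mz_one_sub_X_ne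
    apply mul_left_cancel₀ hX
    have h1 := X_mzD_mzI f hf
    have h2 := mzD_mzJ_one g
    rw [map_add]
    unfold mzD at *
    linear_combination H - (1 - PowerSeries.X) * h1 - PowerSeries.X * h2
  · rw [← PowerSeries.coeff_zero_eq_constantCoeff_apply,
      ← PowerSeries.coeff_zero_eq_constantCoeff_apply, map_add, coeff_mzI, coeff_mzJ, hh]
    simp

lemma coeff_zero_mzJ (s : ℕ) (f : PowerSeries ℝ) : PowerSeries.coeff 0 (mzJ s f) = 0 := by
  simp [coeff_mzJ]

/-- generating series of a word -/
noncomputable def mzZ : List ℕ → PowerSeries ℝ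
  | [] => 1
  | s :: w => mzJ s (mzZ w)

noncomputable def mzF (p : ℕ) : PowerSeries ℝ := mzZ (List.replicate p 2)

noncomputable def mzG : ℕ → PowerSeries ℝ
  | 0 => 0
  | p + 1 => mzJ 1 (mzF p)

lemma mzF_succ (p : ℕ) : mzF (p + 1) = mzJ 2 (mzF p) := rfl
lemma mzF_zero : mzF 0 = 1 := rfl

lemma coeff_zero_mzG (p : ℕ) : PowerSeries.coeff 0 (mzG p) = 0 := by
  cases p with
  | zero => simp [mzG]
  | succ p => exact coeff_zero_mzJ _ _

lemma X_mzD_mzF (p : ℕ) : PowerSeries.X * mzD (mzF p) = mzG p := by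
  cases p with
  | zero => simp [mzF_zero, mzG]
  | succ p =>
    rw [mzF_succ, ← mzI_mzJ, X_mzD_mzI _ (coeff_zero_mzJ _ _)]; rfl

lemma mzD_mzG (p : ℕ) : (1 - PowerSeries.X) * mzD (mzG (p + 1)) = mzF p := mzD_mzJ_one _

lemma mzD_mul (f g : PowerSeries ℝ) : mzD (f * g) = f * mzD g + g * mzD f := by
  unfold mzD
  simp [Derivation.leibniz]

noncomputable def mzA (p q : ℕ) : PowerSeries ℝ := mzF p * mzF q

noncomputable def mzE (p q : ℕ) : PowerSeries ℝ := (1 - PowerSeries.X) * mzD (mzG p * mzG q)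

lemma mzE_zero_left (q : ℕ) : mzE 0 q = 0 := by simp [mzE, mzG]
lemma mzE_zero_right (q : ℕ) : mzE q 0 = 0 := by simp [mzE, mzG]

lemma mzC_eq (p q : ℕ) : mzG p * mzG q = mzJ 1 (mzE p q) := by
  have := mz_unique 0 (mzE p q) (mzG p * mzG q) (by simp)
    (by simp [PowerSeries.coeff_mul, coeff_zero_mzG]) (by rw [mzE]; ring)
  simpa using this

lemma coeff_zero_mul_G (f : PowerSeries ℝ) (q : ℕ) : PowerSeries.coeff 0 (f * mzG q) = 0 := by
  simp [PowerSeries.coeff_mul, coeff_zero_mzG]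

lemma mzE_rec (p q : ℕ) : mzE (p + 1) (q + 1) =
    (2 : ℝ) • mzJ 1 (mzA p q) + mzJ 2 (mzE p (q + 1) + mzE (p + 1) q) := by
  have e1 : mzE (p + 1) (q + 1) = mzF p * mzG (q + 1) + mzF q * mzG (p + 1) := by
    have h1 := mzD_mzG p
    have h2 := mzD_mzG q
    rw [mzE, mzD_mul]
    linear_combination mzG (q + 1) * h1 + mzG (p + 1) * h2
  have e2 := mz_unique (mzG p * mzG (q + 1) + mzG q * mzG (p + 1)) (mzA p q + mzA p q)
    (mzF p * mzG (q + 1) + mzF q * mzG (p + 1))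
    (by rw [map_add, coeff_zero_mul_G, coeff_zero_mul_G, add_zero])
    (by rw [map_add, coeff_zero_mul_G, coeff_zero_mul_G, add_zero])
    (by
      have h1 := mzD_mzG p
      have h2 := mzD_mzG q
      have h3 := X_mzD_mzF p
      have h4 := X_mzD_mzF q
      have : mzD (mzF p * mzG (q + 1) + mzF q * mzG (p + 1)) =
        mzD (mzF p * mzG (q + 1)) + mzD (mzF q * mzG (p + 1)) := map_add _ _ _
      rw [this, mzD_mul, mzD_mul, mzA]
      linear_combination PowerSeries.X * mzF p * h2 + PowerSeries.X * mzF q * h1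
        + (1 - PowerSeries.X) * mzG (q + 1) * h3 + (1 - PowerSeries.X) * mzG (p + 1) * h4)
  rw [e1, e2, mzC_eq, mul_comm (mzG q), mzC_eq, ← map_add, mzI_mzJ, ← two_smul ℝ (mzA p q),
    map_smul, add_comm]

lemma mzA_rec (p q : ℕ) : mzA (p + 1) (q + 1) =
    mzJ 2 (mzA p (q + 1) + mzA (p + 1) q) + (2 : ℝ) • mzJ 3 (mzE (p + 1) (q + 1)) := by
  have e1 := mz_unique (mzF (p + 1) * mzG (q + 1) + mzF (q + 1) * mzG (p + 1)) 0
    (mzA (p + 1) (q + 1))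
    (by rw [map_add, coeff_zero_mul_G, coeff_zero_mul_G, add_zero])
    (by simp [mzA, mzF_succ, PowerSeries.coeff_mul, coeff_zero_mzJ])
    (by
      have h3 := X_mzD_mzF (p + 1)
      have h4 := X_mzD_mzF (q + 1)
      rw [mzA, mzD_mul]
      linear_combination (1 - PowerSeries.X) * mzF (q + 1) * h3
        + (1 - PowerSeries.X) * mzF (p + 1) * h4)
  have e2 := mz_unique (mzG (p + 1) * mzG (q + 1) + mzG (p + 1) * mzG (q + 1))
    (mzA p (q + 1) + mzA (p + 1) q)
    (mzF (p + 1) * mzG (q + 1) + mzF (q + 1) * mzG (p + 1))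
    (by rw [map_add, coeff_zero_mul_G, add_zero])
    (by rw [map_add, coeff_zero_mul_G, coeff_zero_mul_G, add_zero])
    (by
      have h1 := mzD_mzG p
      have h2 := mzD_mzG q
      have h3 := X_mzD_mzF (p + 1)
      have h4 := X_mzD_mzF (q + 1)
      have : mzD (mzF (p + 1) * mzG (q + 1) + mzF (q + 1) * mzG (p + 1)) =
        mzD (mzF (p + 1) * mzG (q + 1)) + mzD (mzF (q + 1) * mzG (p + 1)) := map_add _ _ _
      rw [this, mzD_mul, mzD_mul, mzA, mzA]
      linear_combination PowerSeries.X * mzF (p + 1) * h2 + PowerSeries.X * mzF (q + 1) * h1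
        + (1 - PowerSeries.X) * mzG (q + 1) * h3 + (1 - PowerSeries.X) * mzG (p + 1) * h4)
  rw [e1, e2, mzC_eq, ← two_smul ℝ (mzJ 1 _)]
  simp only [map_add, map_smul, mzI_mzJ, map_zero, add_zero]
  abel

/-! word side -/

noncomputable def mzSh (u v : List ℕ) : PowerSeries ℝ := ((listShuffles u v).map mzZ).sum

lemma mzSh_aux (s : ℕ) (L : List (List ℕ)) :
    ((L.map (s :: ·)).map mzZ).sum = mzJ s ((L.map mzZ).sum) := by
  rw [map_list_sum, List.map_map, List.map_map]
  rfl

lemma mzSh_nil_left (v : List ℕ) : mzSh [] v = mzZ v := by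
  simp [mzSh, listShuffles]

lemma mzSh_nil_right (v : List ℕ) : mzSh v [] = mzZ v := by
  cases v <;> simp [mzSh, listShuffles]

lemma mzSh_cons (a b : ℕ) (u v : List ℕ) :
    mzSh (a :: u) (b :: v) = mzJ a (mzSh u (b :: v)) + mzJ b (mzSh (a :: u) v) := by
  rw [mzSh, listShuffles, List.map_append, List.sum_append, mzSh_aux, mzSh_aux]
  rfl

noncomputable def mzT (a i : ℕ) : PowerSeries ℝ :=
  mzSh (List.replicate a 2) (List.flatten (List.replicate i [3, 1]))

noncomputable def mzS : ℕ → ℕ → PowerSeries ℝ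
  | _, 0 => 0
  | a, i + 1 => mzSh (List.replicate a 2) (1 :: List.flatten (List.replicate i [3, 1]))

lemma mzT_zero_zero : mzT 0 0 = 1 := by simp [mzT, mzSh_nil_left, mzZ]

lemma mzT_zero (a : ℕ) : mzT a 0 = mzF a := by
  simp [mzT, mzSh_nil_right, mzF]

lemma mzT_succ (a i : ℕ) : mzT (a + 1) i = mzJ 2 (mzT a i) + mzJ 3 (mzS (a + 1) i) := by
  cases i with
  | zero => simp [mzT_zero, mzS, mzF_succ]
  | succ i =>
    simp only [mzT, mzS, List.replicate_succ, List.flatten_cons, List.cons_append, List.nil_append]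
    rw [mzSh_cons]

lemma mzT_zero_succ (i : ℕ) : mzT 0 (i + 1) = mzJ 3 (mzS 0 (i + 1)) := by
  simp [mzT, mzS, List.replicate_succ, mzSh_nil_left, mzZ]

lemma mzS_zero_succ (i : ℕ) : mzS 0 (i + 1) = mzJ 1 (mzT 0 i) := by
  simp [mzT, mzS, mzSh_nil_left, mzZ]

lemma mzS_succ (a i : ℕ) : mzS (a + 1) (i + 1) = mzJ 2 (mzS a (i + 1)) + mzJ 1 (mzT (a + 1) i) := by
  simp only [mzT, mzS, List.replicate_succ]
  rw [mzSh_cons]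

noncomputable def mzU (s i : ℕ) : PowerSeries ℝ := if 2 * i ≤ s then mzT (s - 2 * i) i else 0
noncomputable def mzV (s i : ℕ) : PowerSeries ℝ := if 2 * i ≤ s then mzS (s - 2 * i) i else 0

lemma mzU_succ (s i : ℕ) : mzU (s + 1) i = mzJ 2 (mzU s i) + mzJ 3 (mzV (s + 1) i) := by
  rcases lt_trichotomy (2 * i) (s + 1) with h | h | h
  · obtain ⟨a, rfl⟩ : ∃ a, s = 2 * i + a := ⟨s - 2 * i, by omega⟩
    have h1 : 2 * i ≤ 2 * i + a + 1 := by omega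
    have h2 : 2 * i + a + 1 - 2 * i = a + 1 := by omega
    simp [mzU, mzV, h1, h2, mzT_succ]
  · have h1 : ¬ 2 * i ≤ s := by omega
    obtain ⟨j, rfl⟩ : ∃ j, i = j + 1 := ⟨i - 1, by omega⟩
    simp only [mzU, mzV, h1, if_true, if_false, map_zero, zero_add, ← h, Nat.sub_self,
      mzT_zero_succ, le_refl]
  · have h1 : ¬ 2 * i ≤ s := by omega
    have h2 : ¬ 2 * i ≤ s + 1 := by omega
    simp [mzU, mzV, h1, h2]

lemma mzV_succ (s i : ℕ) :
    mzV (s + 2) (i + 1) = mzJ 2 (mzV (s + 1) (i + 1)) + mzJ 1 (mzU s i) := by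
  rcases lt_trichotomy (2 * i) s with h | h | h
  · obtain ⟨a, rfl⟩ : ∃ a, s = 2 * i + a + 1 := ⟨s - 2 * i - 1, by omega⟩
    have h1 : 2 * (i + 1) ≤ 2 * i + a + 1 + 2 := by omega
    have h2 : 2 * (i + 1) ≤ 2 * i + a + 1 + 1 := by omega
    have h3 : 2 * i ≤ 2 * i + a + 1 := by omega
    have e1 : 2 * i + a + 1 + 2 - 2 * (i + 1) = a + 1 := by omega
    have e2 : 2 * i + a + 1 + 1 - 2 * (i + 1) = a := by omega
    have e3 : 2 * i + a + 1 - 2 * i = a + 1 := by omega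
    simp only [mzU, mzV, h1, h2, h3, e1, e2, e3, if_true, mzS_succ]
  · subst h
    have h1 : 2 * (i + 1) ≤ 2 * i + 2 := by omega
    have h2 : ¬ 2 * (i + 1) ≤ 2 * i + 1 := by omega
    have e1 : 2 * i + 2 - 2 * (i + 1) = 0 := by omega
    simp only [mzU, mzV, h1, h2, e1, if_true, if_false, map_zero, zero_add, le_refl, Nat.sub_self,
      mzS_zero_succ]
  · have h1 : ¬ 2 * i ≤ s := by omega
    have h2 : ¬ 2 * (i + 1) ≤ s + 2 := by omega
    have h3 : ¬ 2 * (i + 1) ≤ s + 1 := by omega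
    simp only [mzU, mzV, h1, h2, h3, if_false, map_zero, zero_add]

lemma mzV_zero (s : ℕ) : mzV s 0 = 0 := by simp [mzV, mzS]

noncomputable def mzc (p q i : ℕ) : ℝ :=
  if i ≤ p ∧ i ≤ q then (Nat.choose (p + q - 2 * i) (p - i) : ℝ) else 0

lemma mzc_succ (p q i : ℕ) : mzc (p + 1) (q + 1) (i + 1) = mzc p q i := by
  have : p + 1 + (q + 1) - 2 * (i + 1) = p + q - 2 * i := by omega
  simp [mzc, this]

lemma mzc_pascal (p q i : ℕ) (h : 2 * i ≤ p + q + 1) :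
    mzc (p + 1) (q + 1) i = mzc p (q + 1) i + mzc (p + 1) q i := by
  by_cases hp : i ≤ p
  · obtain ⟨a, rfl⟩ : ∃ a, p = i + a := ⟨p - i, by omega⟩
    by_cases hq : i ≤ q
    · obtain ⟨b, rfl⟩ : ∃ b, q = i + b := ⟨q - i, by omega⟩
      have e1 : i + a + 1 + (i + b + 1) - 2 * i = (a + b + 1) + 1 := by omega
      have e2 : i + a + (i + b + 1) - 2 * i = a + b + 1 := by omega
      have e3 : i + a + 1 + (i + b) - 2 * i = a + b + 1 := by omega
      have e4 : i + a + 1 - i = a + 1 := by omega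
      have e5 : i + a - i = a := by omega
      have h1 : i ≤ i + a + 1 := by omega
      have h2 : i ≤ i + b + 1 := by omega
      simp only [mzc, e1, e2, e3, e4, e5, h1, h2, hp, hq, and_self, if_true]
      rw [Nat.choose_succ_succ]; push_cast; ring
    · by_cases hq' : i = q + 1
      · subst hq'
        have e1 : q + 1 + a + 1 + (q + 1) - 2 * (q + 1) = a + 1 := by omega
        have e2 : q + 1 + a + (q + 1) - 2 * (q + 1) = a := by omega
        have e3 : q + 1 + a + 1 - (q + 1) = a + 1 := by omega
        have e4 : q + 1 + a - (q + 1) = a := by omega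
        simp [mzc, e1, e2, e3, e4]
        omega
      · have h1 : ¬ i ≤ q + 1 := by omega
        simp [mzc, hq, h1]
  · have hp' : i = p + 1 ∨ p + 1 < i := by omega
    rcases hp' with rfl | hp'
    · have : p + 1 ≤ q := by omega
      have h2 : p + 1 ≤ q + 1 := by omega
      simp [mzc, this]; omega
    · have h1 : ¬ i ≤ p + 1 := by omega
      simp [mzc, hp, h1]

lemma mzc_zero_left (q i : ℕ) : mzc 0 q i = if i = 0 then 1 else 0 := by
  by_cases h : i = 0 <;> simp [mzc, h]

lemma mzc_zero_right (q i : ℕ) : mzc q 0 i = if i = 0 then 1 else 0 := by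
  by_cases h : i = 0 <;> simp [mzc, h]

lemma mz_pascal_U (p q i : ℕ) : mzc (p + 1) (q + 1) i • mzU (p + q + 1) i =
    mzc p (q + 1) i • mzU (p + q + 1) i + mzc (p + 1) q i • mzU (p + q + 1) i := by
  by_cases h : 2 * i ≤ p + q + 1
  · rw [mzc_pascal p q i h, add_smul]
  · simp [mzU, h]

lemma mz_pascal_V (p q i : ℕ) : mzc (p + 1) (q + 1) i • mzV (p + q + 1) i =
    mzc p (q + 1) i • mzV (p + q + 1) i + mzc (p + 1) q i • mzV (p + q + 1) i := by
  by_cases h : 2 * i ≤ p + q + 1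
  · rw [mzc_pascal p q i h, add_smul]
  · simp [mzV, h]

lemma mz_main (s : ℕ) : ∀ p q N : ℕ, p + q = s → p + q < N →
    mzA p q = ∑ i ∈ Finset.range N, (4 : ℝ) ^ i • mzc p q i • mzU (p + q) i ∧
    mzE p q = (2 : ℝ) • ∑ i ∈ Finset.range N,
      (4 : ℝ) ^ i • mzc p q (i + 1) • mzV (p + q) (i + 1) := by
  induction s using Nat.strong_induction_on with
  | _ s ih =>
  intro p q N hs hN
  have h0 : 0 ∈ Finset.range N := by simp; omega
  rcases p with _ | p
  · constructor
    · rw [Finset.sum_eq_single_of_mem 0 h0]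
      · simp [mzc_zero_left, mzU, mzT_zero, mzA, mzF_zero]
      · intro i _ hi
        simp [mzc_zero_left, hi]
    · simp [mzE_zero_left, mzc_zero_left]
  rcases q with _ | q
  · constructor
    · rw [Finset.sum_eq_single_of_mem 0 h0]
      · simp [mzc_zero_right, mzU, mzT_zero, mzA, mzF_zero]
      · intro i _ hi
        simp [mzc_zero_right, hi]
    · simp [mzE_zero_right, mzc_zero_right]
  have i1 := ih (p + q) (by omega) p q N rfl (by omega)
  have i2 := ih (p + (q + 1)) (by omega) p (q + 1) N rfl (by omega)
  have i3 := ih (p + 1 + q) (by omega) (p + 1) q N rfl (by omega)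
  have e2 : p + (q + 1) = p + q + 1 := by omega
  have e3 : p + 1 + q = p + q + 1 := by omega
  have e4 : p + 1 + (q + 1) = p + q + 1 + 1 := by omega
  rw [e2] at i2
  rw [e3] at i3
  have hE : mzE (p + 1) (q + 1) = (2 : ℝ) • ∑ i ∈ Finset.range N,
      (4 : ℝ) ^ i • mzc (p + 1) (q + 1) (i + 1) • mzV (p + q + 1 + 1) (i + 1) := by
    rw [mzE_rec, i1.1, i2.2, i3.2, ← smul_add, map_smul, ← smul_add, map_sum,
      ← Finset.sum_add_distrib, map_sum, ← Finset.sum_add_distrib]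
    congr 1
    refine Finset.sum_congr rfl fun i _ => ?_
    rw [← smul_add, ← mz_pascal_V, map_smul, map_smul, map_smul, map_smul, ← smul_add,
      mzc_succ, ← smul_add, mzV_succ, add_comm (mzJ 1 _)]
  rw [e4]
  refine ⟨?_, hE⟩
  obtain ⟨M, rfl⟩ : ∃ M, N = M + 1 := ⟨N - 1, by omega⟩
  rw [mzA_rec, i2.1, i3.1]
  have hE' : mzE (p + 1) (q + 1) = (2 : ℝ) • ∑ i ∈ Finset.range M,
      (4 : ℝ) ^ i • mzc (p + 1) (q + 1) (i + 1) • mzV (p + q + 1 + 1) (i + 1) := by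
    rw [hE, Finset.sum_range_succ]
    have : mzV (p + q + 1 + 1) (M + 1) = 0 := by
      have : ¬ 2 * (M + 1) ≤ p + q + 1 + 1 := by omega
      simp only [mzV, this, if_false]
    rw [this]; simp
  have hE'' : (2 : ℝ) • mzE (p + 1) (q + 1) = ∑ i ∈ Finset.range (M + 1),
      (4 : ℝ) ^ i • mzc (p + 1) (q + 1) i • mzV (p + q + 1 + 1) i := by
    rw [Finset.sum_range_succ', mzV_zero, smul_zero, smul_zero, add_zero, hE', smul_smul,
      Finset.smul_sum]
    refine Finset.sum_congr rfl fun i _ => ?_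
    rw [smul_smul]; congr 1; rw [pow_succ]; ring
  rw [← map_smul, hE'', ← Finset.sum_add_distrib, map_sum, map_sum, ← Finset.sum_add_distrib]
  refine Finset.sum_congr rfl fun i _ => ?_
  rw [← smul_add, ← mz_pascal_U, map_smul, map_smul, map_smul, map_smul, ← smul_add, ← smul_add,
    mzU_succ (p + q + 1)]

/-! evaluation -/

open scoped ENNReal

lemma coeff_mzZ_nonneg (w : List ℕ) (n : ℕ) : 0 ≤ PowerSeries.coeff n (mzZ w) := by
  induction w generalizing n with
  | nil => simp only [mzZ, PowerSeries.coeff_one]; split_ifs <;> norm_num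
  | cons s w ih =>
    rw [mzZ, coeff_mzJ]
    exact div_nonneg (Finset.sum_nonneg fun k _ => ih k) (by positivity)

open Classical in
noncomputable def mzW (s : List ℕ) (N : ℕ∞) : ℝ≥0∞ :=
  ∑' k : Fin s.length → ℕ, if (StrictAnti k ∧ ∀ i, 0 < k i) ∧ ∀ i, (k i : ℕ∞) < N then
    ENNReal.ofReal (∏ i, 1 / ((k i : ℝ) ^ s.get i)) else 0

lemma mz_strictAnti_cons {d : ℕ} (n : ℕ) (k : Fin d → ℕ) (N : ℕ∞) :
    ((StrictAnti (Fin.cons n k : Fin (d + 1) → ℕ) ∧ ∀ i, 0 < (Fin.cons n k : Fin (d + 1) → ℕ) i) ∧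
      ∀ i, (((Fin.cons n k : Fin (d + 1) → ℕ) i : ℕ) : ℕ∞) < N) ↔
    (0 < n ∧ (n : ℕ∞) < N) ∧ ((StrictAnti k ∧ ∀ i, 0 < k i) ∧ ∀ i, (k i : ℕ∞) < (n : ℕ∞)) := by
  constructor
  · rintro ⟨⟨h1, h2⟩, h3⟩
    refine ⟨⟨by simpa using h2 0, by simpa using h3 0⟩, ⟨fun i j hij => ?_, fun i => ?_⟩, fun i => ?_⟩
    · simpa using h1 (Fin.succ_lt_succ_iff.mpr hij)
    · simpa using h2 i.succ
    · have := h1 (Fin.succ_pos i)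
      simpa using this
  · rintro ⟨⟨h1, h2⟩, ⟨h3, h4⟩, h5⟩
    refine ⟨⟨fun i j hij => ?_, fun i => ?_⟩, fun i => ?_⟩
    · induction i using Fin.cases with
      | zero =>
        induction j using Fin.cases with
        | zero => exact absurd hij (lt_irrefl _)
        | succ j => simpa using h5 j
      | succ i =>
        induction j using Fin.cases with
        | zero => exact absurd hij (by simp)
        | succ j => simpa using h3 (Fin.succ_lt_succ_iff.mp hij)
    · induction i using Fin.cases with
      | zero => simpa using h1
      | succ i => simpa using h4 i
    · induction i using Fin.cases with
      | zero => simpa using h2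
      | succ i => simpa using (h5 i).trans h2

open Classical in
lemma mzW_cons (s : ℕ) (w : List ℕ) (N : ℕ∞) :
    mzW (s :: w) N = ∑' n : ℕ, if 0 < n ∧ (n : ℕ∞) < N then
      ENNReal.ofReal (1 / (n : ℝ) ^ s) * mzW w n else 0 := by
  unfold mzW
  have e := (Fin.consEquiv (fun _ : Fin (w.length + 1) => ℕ)).tsum_eq
    (fun k : Fin (w.length + 1) → ℕ =>
      if (StrictAnti k ∧ ∀ i, 0 < k i) ∧ ∀ i, (k i : ℕ∞) < N then
    ENNReal.ofReal (∏ i, 1 / ((k i : ℝ) ^ (s :: w).get i)) else 0)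
  refine e.symm.trans ?_
  rw [ENNReal.tsum_prod']
  refine tsum_congr fun n => ?_
  simp only [Fin.consEquiv, Equiv.coe_fn_mk, mz_strictAnti_cons]
  by_cases h : 0 < n ∧ (n : ℕ∞) < N
  · rw [if_pos h, ← ENNReal.tsum_mul_left]
    refine tsum_congr fun k => ?_
    by_cases hk : (StrictAnti k ∧ ∀ i, 0 < k i) ∧ ∀ i, (k i : ℕ∞) < (n : ℕ∞)
    · rw [if_pos ⟨h, hk⟩, if_pos hk, ← ENNReal.ofReal_mul (by positivity)]
      congr 1
      exact Fin.prod_univ_succ _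
    · rw [if_neg (fun hh => hk hh.2), if_neg hk, mul_zero]
  · rw [if_neg h]
    simp [h]

open Classical in
lemma mzW_eq (s : List ℕ) (N : ℕ∞) (hN : 0 < N) :
    mzW s N = ∑' n : ℕ, if (n : ℕ∞) < N then ENNReal.ofReal (PowerSeries.coeff n (mzZ s)) else 0 := by
  induction s generalizing N with
  | nil =>
    rw [tsum_eq_single 0]
    · simp [mzW, mzZ, hN, Subsingleton.strictAnti]
    · intro n hn
      simp [mzZ, PowerSeries.coeff_one, hn]
  | cons s w ih =>
    rw [mzW_cons]
    refine tsum_congr fun n => ?_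
    rcases Nat.eq_zero_or_pos n with rfl | hn
    · simp [mzZ, coeff_zero_mzJ]
    · by_cases h : (n : ℕ∞) < N
      · rw [if_pos ⟨hn, h⟩, if_pos h, ih n (by exact_mod_cast hn), mzZ, coeff_mzJ]
        rw [tsum_eq_sum (s := Finset.range n)]
        · rw [div_eq_mul_one_div (Finset.sum _ _), mul_comm (Finset.sum _ _), ENNReal.ofReal_mul (by positivity),
            ENNReal.ofReal_sum_of_nonneg (fun i _ => coeff_mzZ_nonneg w i)]
          congr 1
          refine Finset.sum_congr rfl fun k hk => ?_
          rw [if_pos]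
          exact_mod_cast Finset.mem_range.mp hk
        · intro k hk
          rw [if_neg]
          simpa using hk
      · rw [if_neg h, if_neg (fun hh => h hh.2)]

lemma mzv_eq (s : List ℕ) : mzv s = ∑' n : ℕ, PowerSeries.coeff n (mzZ s) := by
  classical
  have h1 : mzv s = (mzW s ⊤).toReal := by
    rw [mzv, mzW]
    have : ∀ k : {k : Fin s.length → ℕ // StrictAnti k ∧ ∀ i, 0 < k i},
      ∏ i, 1 / ((k.1 i : ℝ) ^ s.get i) =
        (ENNReal.ofReal (∏ i, 1 / ((k.1 i : ℝ) ^ s.get i))).toReal := fun k => by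
      rw [ENNReal.toReal_ofReal]
      exact Finset.prod_nonneg fun i _ => by positivity
    rw [tsum_congr this, ← ENNReal.tsum_toReal_eq (fun _ => ENNReal.ofReal_ne_top)]
    congr 1
    refine (tsum_subtype {k : Fin s.length → ℕ | StrictAnti k ∧ ∀ i, 0 < k i}
      (fun k => ENNReal.ofReal (∏ i, 1 / ((k i : ℝ) ^ s.get i)))).trans ?_
    refine tsum_congr fun k => ?_
    simp [Set.indicator_apply]
  rw [h1, mzW_eq s ⊤ (by simp)]
  rw [ENNReal.tsum_toReal_eq (fun n => by split_ifs <;> simp)]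
  refine tsum_congr fun n => ?_
  simp [coeff_mzZ_nonneg]

lemma mzF_bound (p : ℕ) : Summable (fun n => PowerSeries.coeff n (mzF p)) ∧
    ∑' n, PowerSeries.coeff n (mzF p) ≤ (∑' n : ℕ, 1 / (n : ℝ) ^ 2) ^ p := by
  have hz : Summable (fun n : ℕ => 1 / (n : ℝ) ^ 2) :=
    Real.summable_one_div_nat_pow.mpr (by norm_num)
  induction p with
  | zero =>
    have : HasSum (fun n => PowerSeries.coeff n (mzF 0)) (1 : ℝ) := by
      have := hasSum_ite_eq (0 : ℕ) (1 : ℝ)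
      simpa [mzF_zero, PowerSeries.coeff_one] using this
    refine ⟨this.summable, ?_⟩
    rw [this.tsum_eq]; simp
  | succ p ih =>
    obtain ⟨h1, h2⟩ := ih
    set M := ∑' n : ℕ, 1 / (n : ℝ) ^ 2
    have hb : ∀ n, PowerSeries.coeff n (mzF (p + 1)) ≤ (1 / (n : ℝ) ^ 2) * M ^ p := by
      intro n
      rw [mzF_succ, coeff_mzJ, div_eq_mul_one_div, mul_comm]
      refine mul_le_mul_of_nonneg_left (le_trans ?_ h2) (by positivity)
      exact h1.sum_le_tsum _ (fun i _ => coeff_mzZ_nonneg _ i)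
    have hs : Summable fun n : ℕ => (1 / (n : ℝ) ^ 2) * M ^ p := hz.mul_right _
    have h3 : Summable (fun n => PowerSeries.coeff n (mzF (p + 1))) :=
      Summable.of_nonneg_of_le (fun n => coeff_mzZ_nonneg _ n) hb hs
    refine ⟨h3, (h3.tsum_le_tsum hb hs).trans ?_⟩
    rw [tsum_mul_right, pow_succ, mul_comm]

noncomputable def mzP (r N : ℕ) : ℝ := ∑ k ∈ Finset.range N, PowerSeries.coeff k (mzF r)

lemma mzP_nonneg (r N : ℕ) : 0 ≤ mzP r N := Finset.sum_nonneg fun i _ => coeff_mzZ_nonneg _ i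

lemma mzP_le (r N : ℕ) : mzP r N ≤ (∑' n : ℕ, 1 / (n : ℝ) ^ 2) ^ r :=
  ((mzF_bound r).1.sum_le_tsum _ (fun i _ => coeff_mzZ_nonneg _ i)).trans (mzF_bound r).2

lemma mzP_succ (r N : ℕ) : mzP (r + 1) (N + 1) = mzP (r + 1) N + mzP r N / (N : ℝ) ^ 2 := by
  rw [mzP, Finset.sum_range_succ, mzF_succ, coeff_mzJ]; rfl

lemma mzP_zero (N : ℕ) : mzP 0 (N + 1) = 1 := by
  rw [mzP, Finset.sum_range_succ']
  simp [mzF_zero, PowerSeries.coeff_one]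

lemma mzP_one (r : ℕ) : mzP (r + 1) 1 = 0 := by
  simp [mzP, mzF_succ, coeff_zero_mzJ]

lemma mzP_hasSum (y : ℝ) (N : ℕ) : HasSum (fun r => (-y) ^ r * mzP r (N + 1))
    (∏ j ∈ Finset.range N, (1 - y / ((j : ℝ) + 1) ^ 2)) := by
  induction N with
  | zero =>
    have := hasSum_ite_eq (0 : ℕ) (1 : ℝ)
    rw [Finset.prod_range_zero]
    have e : (fun r => (-y) ^ r * mzP r (0 + 1)) = fun r => if r = 0 then 1 else 0 := by
      ext r
      rcases r with _ | r
      · simp [mzP_zero]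
      · simp [mzP_one]
    rw [e]
    exact this
  | succ N ih =>
    rw [Finset.prod_range_succ]
    have h1 : HasSum (fun r => (-y) ^ (r + 1) * mzP (r + 1) (N + 1))
        (∏ j ∈ Finset.range N, (1 - y / ((j : ℝ) + 1) ^ 2) - 1) := by
      have := (hasSum_nat_add_iff' 1).mpr ih
      simpa [mzP_zero] using this
    have h2 := h1.add (ih.mul_left (-y / ((N : ℝ) + 1) ^ 2))
    have h3 := (hasSum_nat_add_iff' (f := fun r => (-y) ^ r * mzP r (N + 1 + 1))
      (g := (∏ j ∈ Finset.range N, (1 - y / ((j : ℝ) + 1) ^ 2)) * (1 - y / ((N : ℝ) + 1) ^ 2)) 1).mp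
    apply h3
    have e : (fun r => (-y) ^ (r + 1) * mzP (r + 1) (N + 1 + 1)) = fun b =>
        (-y) ^ (b + 1) * mzP (b + 1) (N + 1) + -y / ((N : ℝ) + 1) ^ 2 * ((-y) ^ b * mzP b (N + 1)) := by
      ext r
      rw [mzP_succ]; push_cast; ring
    rw [e]
    have e' : (∏ j ∈ Finset.range N, (1 - y / ((j : ℝ) + 1) ^ 2)) * (1 - y / ((N : ℝ) + 1) ^ 2) -
        ∑ i ∈ Finset.range 1, (-y) ^ i * mzP i (N + 1 + 1) =
        ∏ j ∈ Finset.range N, (1 - y / ((j : ℝ) + 1) ^ 2) - 1 +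
        -y / ((N : ℝ) + 1) ^ 2 * ∏ j ∈ Finset.range N, (1 - y / ((j : ℝ) + 1) ^ 2) := by
      simp [mzP_zero]; ring
    rw [e']
    exact h2

lemma mz_unique_series (a : ℕ → ℝ) (M : ℝ) (hM : 0 < M) (hb : ∀ r, |a r| ≤ M ^ r)
    (h0 : ∀ y : ℝ, 0 < y → y * M < 1 → ∑' r, y ^ r * a r = 0) (r : ℕ) : a r = 0 := by
  let p := FormalMultilinearSeries.ofScalars ℝ a
  have hsum : ∀ y : ℝ, ‖y‖ < 1 / M → Summable (fun r => y ^ r * a r) := by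
    intro y hy
    refine Summable.of_norm_bounded (g := fun r => (‖y‖ * M) ^ r) ?_ ?_
    · apply summable_geometric_of_lt_one (by positivity)
      rwa [lt_div_iff₀ hM] at hy
    · intro r
      rw [norm_mul, norm_pow, mul_pow]
      exact mul_le_mul_of_nonneg_left (hb r) (by positivity)
  have hp : HasFPowerSeriesAt (fun y : ℝ => ∑' r, y ^ r * a r) p 0 := by
    rw [hasFPowerSeriesAt_iff]
    filter_upwards [Metric.ball_mem_nhds (0 : ℝ) (ε := 1 / M) (by positivity)] with z hz
    have : ‖z‖ < 1 / M := by simpa using hz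
    simpa [p, FormalMultilinearSeries.coeff_ofScalars] using (hsum z this).hasSum
  by_contra hr
  have hpne : p ≠ 0 := by
    intro h
    have := congrArg (fun q => q.coeff r) h
    apply hr
    have h0 : (0 : FormalMultilinearSeries ℝ ℝ ℝ).coeff r = 0 := by
      simp [FormalMultilinearSeries.coeff]
    simpa [p, FormalMultilinearSeries.coeff_ofScalars, h0] using this
  have h1 := hp.locally_ne_zero hpne
  have h2 : ∀ᶠ z in nhdsWithin (0 : ℝ) (Set.Ioi 0), ∑' r, z ^ r * a r ≠ 0 :=
    h1.filter_mono (nhdsWithin_mono _ (fun z hz => ne_of_gt hz))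
  have h3 : ∀ᶠ z in nhdsWithin (0 : ℝ) (Set.Ioi 0), z ∈ Set.Ioo (0 : ℝ) (1 / M) :=
    Ioo_mem_nhdsGT (by positivity)
  obtain ⟨z, hz1, hz2⟩ := (h2.and h3).exists
  exact hz1 (h0 z hz2.1 (by rw [← lt_div_iff₀ hM]; exact hz2.2))

lemma mz_zeta_two (r : ℕ) : ∑' n, PowerSeries.coeff n (mzF r) =
    Real.pi ^ (2 * r) / (Nat.factorial (2 * r + 1)) := by
  set K := ∑' n : ℕ, 1 / (n : ℝ) ^ 2 with hK
  have hK0 : 0 ≤ K := tsum_nonneg fun n => by positivity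
  set z : ℕ → ℝ := fun r => ∑' n, PowerSeries.coeff n (mzF r) with hz
  have hz0 : ∀ r, 0 ≤ z r := fun r => tsum_nonneg fun n => coeff_mzZ_nonneg _ n
  have hzK : ∀ r, z r ≤ K ^ r := fun r => (mzF_bound r).2
  set b : ℕ → ℝ := fun r => Real.pi ^ (2 * r) / (Nat.factorial (2 * r + 1)) with hbdef
  have hb0 : ∀ r, 0 ≤ b r := fun r => by positivity
  have hbK : ∀ r, b r ≤ (Real.pi ^ 2) ^ r := fun r => by
    rw [hbdef]
    simp only
    rw [← pow_mul]
    exact div_le_self (by positivity) (by exact_mod_cast Nat.succ_le_of_lt (Nat.factorial_pos _))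
  have hM : 0 < K + Real.pi ^ 2 + 1 := by positivity
  have key := mz_unique_series (fun r => (-1) ^ r * (z r - b r)) (K + Real.pi ^ 2 + 1) hM ?_ ?_ r
  · have : (-1 : ℝ) ^ r ≠ 0 := by simp
    have h := (mul_eq_zero.mp key).resolve_left this
    linarith
  · intro r
    have h1 : K ^ r ≤ (K + Real.pi ^ 2 + 1) ^ r :=
      pow_le_pow_left₀ hK0 (by nlinarith [Real.pi_pos]) r
    have h2 : (Real.pi ^ 2) ^ r ≤ (K + Real.pi ^ 2 + 1) ^ r :=
      pow_le_pow_left₀ (by positivity) (by linarith) r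
    have := hz0 r
    have := hzK r
    have := hb0 r
    have := hbK r
    rw [abs_mul, abs_pow, abs_neg, abs_one, one_pow, one_mul, abs_le]
    constructor <;> linarith
  · intro y hy hyM
    have hyK : y * K < 1 := lt_of_le_of_lt
      (mul_le_mul_of_nonneg_left (by nlinarith [Real.pi_pos]) hy.le) hyM
    set x := Real.sqrt y with hx
    have hx2 : x ^ 2 = y := Real.sq_sqrt hy.le
    have hx0 : 0 < x := Real.sqrt_pos.mpr hy
    have hpx : Real.pi * x ≠ 0 := by positivity
    -- limit one
    have hbound : Summable fun r : ℕ => (y * K) ^ r :=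
      summable_geometric_of_lt_one (by positivity) hyK
    have T1 : Filter.Tendsto (fun N => ∑' r, (-y) ^ r * mzP r (N + 1)) Filter.atTop
        (nhds (∑' r, (-y) ^ r * z r)) := by
      refine tendsto_tsum_of_dominated_convergence hbound ?_ ?_
      · intro r
        refine Filter.Tendsto.const_mul _ ?_
        exact ((mzF_bound r).1.hasSum.tendsto_sum_nat).comp (Filter.tendsto_add_atTop_nat 1)
      · refine Filter.Eventually.of_forall fun N r => ?_
        rw [norm_mul, norm_pow, norm_neg, mul_pow, Real.norm_of_nonneg hy.le,
          Real.norm_of_nonneg (mzP_nonneg _ _)]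
        exact mul_le_mul_of_nonneg_left (mzP_le _ _) (by positivity)
    have T2 := Real.tendsto_euler_sin_prod x
    have T3 : Filter.Tendsto (fun N => Real.pi * x * ∑' r, (-y) ^ r * mzP r (N + 1)) Filter.atTop
        (nhds (Real.sin (Real.pi * x))) := by
      refine T2.congr fun N => ?_
      rw [(mzP_hasSum y N).tsum_eq, hx2]
    have E1 : Real.pi * x * ∑' r, (-y) ^ r * z r = Real.sin (Real.pi * x) :=
      tendsto_nhds_unique (T1.const_mul _) T3
    have E2 : HasSum (fun r => (-y) ^ r * b r) (Real.sin (Real.pi * x) / (Real.pi * x)) := by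
      have := (Real.hasSum_sin (Real.pi * x)).div_const (Real.pi * x)
      have e : (fun r => (-y) ^ r * b r) = fun i =>
          (-1) ^ i * (Real.pi * x) ^ (2 * i + 1) / ((2 * i + 1).factorial : ℝ) / (Real.pi * x) := by
        ext r
        rw [hbdef]
        simp only
        rw [← hx2, neg_pow, pow_succ (Real.pi * x), mul_pow Real.pi x, ← pow_mul]
        field_simp
      rw [e]
      exact this
    have S1 : Summable fun r => (-y) ^ r * z r := by
      refine Summable.of_norm_bounded hbound fun r => ?_
      rw [norm_mul, norm_pow, norm_neg, mul_pow, Real.norm_of_nonneg hy.le,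
          Real.norm_of_nonneg (hz0 _)]
      exact mul_le_mul_of_nonneg_left (hzK _) (by positivity)
    have : ∀ r, y ^ r * ((-1) ^ r * (z r - b r)) = (-y) ^ r * z r - (-y) ^ r * b r := fun r => by
      rw [neg_pow]; ring
    rw [tsum_congr this, S1.tsum_sub E2.summable, E2.tsum_eq, ← E1]
    field_simp
    ring

lemma coeff_list_sum (L : List (PowerSeries ℝ)) (n : ℕ) :
    PowerSeries.coeff n L.sum = (L.map (PowerSeries.coeff n)).sum := map_list_sum _ _

lemma coeff_mzT_nonneg (a i n : ℕ) : 0 ≤ PowerSeries.coeff n (mzT a i) := by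
  rw [mzT, mzSh, coeff_list_sum]
  apply List.sum_nonneg
  intro x hx
  simp only [List.map_map, List.mem_map, Function.comp] at hx
  obtain ⟨w, _, rfl⟩ := hx
  exact coeff_mzZ_nonneg w n

lemma coeff_mzU_nonneg (s i n : ℕ) : 0 ≤ PowerSeries.coeff n (mzU s i) := by
  unfold mzU
  split_ifs
  · exact coeff_mzT_nonneg _ _ _
  · simp

lemma mzc_nonneg (p q i : ℕ) : 0 ≤ mzc p q i := by
  unfold mzc
  split_ifs <;> positivity

lemma mzA_hasSum (p q : ℕ) : HasSum (fun n => PowerSeries.coeff n (mzA p q))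
    ((∑' n, PowerSeries.coeff n (mzF p)) * ∑' n, PowerSeries.coeff n (mzF q)) := by
  have h1 := (mzF_bound p).1.norm
  have h2 := (mzF_bound q).1.norm
  rw [tsum_mul_tsum_eq_tsum_sum_antidiagonal_of_summable_norm h1 h2]
  have := (summable_norm_sum_mul_antidiagonal_of_summable_norm h1 h2).of_norm.hasSum
  simp only [mzA, PowerSeries.coeff_mul]
  exact this

lemma mzT_summable (a i : ℕ) : Summable fun n => PowerSeries.coeff n (mzT a i) := by
  refine Summable.of_nonneg_of_le (fun n => coeff_mzT_nonneg a i n) (fun n => ?_)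
    (mzA_hasSum i (a + i)).summable
  rw [(mz_main _ i (a + i) (i + (a + i) + 1) rfl (by omega)).1, map_sum]
  have hmem : i ∈ Finset.range (i + (a + i) + 1) := by
    rw [Finset.mem_range]; omega
  refine le_trans ?_ (Finset.single_le_sum (fun j _ => ?_) hmem)
  · have e1 : 2 * i ≤ i + (a + i) := by omega
    have e2 : i + (a + i) - 2 * i = a := by omega
    have hc : mzc i (a + i) i = 1 := by simp [mzc]
    rw [map_smul, map_smul, hc, one_smul, mzU, if_pos e1, e2, smul_eq_mul]
    exact le_mul_of_one_le_left (coeff_mzT_nonneg _ _ _) (one_le_pow₀ (by norm_num))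
  · rw [map_smul, map_smul, smul_eq_mul, smul_eq_mul]
    exact mul_nonneg (by positivity) (mul_nonneg (mzc_nonneg _ _ _) (coeff_mzU_nonneg _ _ _))

lemma mz_list_hasSum (L : List (List ℕ))
    (h : ∀ w ∈ L, Summable fun n => PowerSeries.coeff n (mzZ w)) :
    HasSum (fun n => PowerSeries.coeff n (L.map mzZ).sum) (L.map mzv).sum := by
  induction L with
  | nil => simp
  | cons w L ih =>
    simp only [List.map_cons, List.sum_cons, map_add]
    refine HasSum.add ?_ (ih fun v hv => h v (List.mem_cons_of_mem _ hv))
    rw [mzv_eq]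
    exact (h w List.mem_cons_self).hasSum

lemma zetaShuffle_hasSum (a i : ℕ) : HasSum (fun n => PowerSeries.coeff n (mzT a i))
    (zetaShuffle (List.replicate a 2) (List.flatten (List.replicate i [3, 1]))) := by
  refine mz_list_hasSum _ fun w hw => ?_
  refine Summable.of_nonneg_of_le (fun n => coeff_mzZ_nonneg w n) (fun n => ?_) (mzT_summable a i)
  rw [mzT, mzSh, coeff_list_sum, List.map_map]
  refine List.single_le_sum ?_ _ ?_
  · intro x hx
    simp only [List.mem_map, Function.comp] at hx
    obtain ⟨w, _, rfl⟩ := hx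
    exact coeff_mzZ_nonneg w n
  · exact List.mem_map.mpr ⟨w, hw, rfl⟩

lemma mz_product (n p q : ℕ) (h : p + q = 2 * n) :
    (Real.pi ^ (2 * p) / (Nat.factorial (2 * p + 1))) *
      (Real.pi ^ (2 * q) / (Nat.factorial (2 * q + 1))) =
    ∑ j ∈ Finset.range (n + 1), (4 : ℝ) ^ (n - j) * (mzc p q (n - j) *
      zetaShuffle (List.replicate (2 * j) 2) (List.flatten (List.replicate (n - j) [3, 1]))) := by
  rw [← mz_zeta_two, ← mz_zeta_two]
  refine (mzA_hasSum p q).unique ?_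
  rw [(mz_main _ p q (2 * n + 1) rfl (by omega)).1, h]
  rw [← Finset.sum_subset (s₁ := Finset.range (n + 1))
    (by intro x; simp only [Finset.mem_range]; omega)
    (by
      intro i _ hi
      have : ¬ 2 * i ≤ 2 * n := by simp at hi; omega
      simp only [mzU, this, if_false, smul_zero])]
  rw [← Finset.sum_range_reflect]
  simp only [map_sum, map_smul, smul_eq_mul]
  refine hasSum_sum fun j hj => ?_
  have hj' : j ≤ n := by simp at hj; omega
  have e1 : n + 1 - 1 - j = n - j := by omega
  have e2 : 2 * (n - j) ≤ 2 * n := by omega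
  have e3 : 2 * n - 2 * (n - j) = 2 * j := by omega
  rw [e1, mzU, if_pos e2, e3]
  exact ((zetaShuffle_hasSum (2 * j) (n - j)).mul_left _).mul_left _

lemma mz_a_zero (m j : ℕ) (h : m < j) : (∑ k ∈ Finset.Icc (-(j : ℤ)) (j : ℤ),
            (k.negOnePow : ℤ) * k ^ (2 * m) *
              (Nat.choose (2 * j) ((j : ℤ) - k).toNat : ℤ) : ℤ) = 0 := by
  have h1 := congrFun (fwdDiff_iter_pow_eq_zero_of_lt (R := ℤ) (j := 2 * m) (n := 2 * j) (by omega))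
    (-(j : ℤ))
  rw [fwdDiff_iter_eq_sum_shift] at h1
  have h2 : (∑ k ∈ Finset.Icc (-(j : ℤ)) (j : ℤ),
            (k.negOnePow : ℤ) * k ^ (2 * m) *
              (Nat.choose (2 * j) ((j : ℤ) - k).toNat : ℤ) : ℤ) =
      (-1) ^ j * ∑ k ∈ Finset.range (2 * j + 1),
        ((-1 : ℤ) ^ (2 * j - k) * ((2 * j).choose k : ℤ)) • (-(j : ℤ) + k • (1 : ℤ)) ^ (2 * m) := by
    rw [Finset.mul_sum]
    refine Finset.sum_bij' (fun k _ => (k + j).toNat) (fun l _ => (l : ℤ) - j) ?_ ?_ ?_ ?_ ?_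
    · intro k hk; simp at hk ⊢; omega
    · intro l hl; simp at hl ⊢; omega
    · intro k hk; simp at hk ⊢; omega
    · intro l hl; simp
    · intro k hk
      simp only [Finset.mem_Icc] at hk
      obtain ⟨l, hl⟩ : ∃ l : ℕ, k = (l : ℤ) - j := ⟨(k + j).toNat, by omega⟩
      subst hl
      have hl2 : l ≤ 2 * j := by omega
      have e1 : ((l : ℤ) - j + j).toNat = l := by omega
      have e2 : ((j : ℤ) - ((l : ℤ) - j)).toNat = 2 * j - l := by omega
      rw [e1, e2, Nat.choose_symm hl2]
      have e3 : (((l : ℤ) - j).negOnePow : ℤ) = (-1) ^ j * (-1) ^ (2 * j - l) := by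
        have : (l : ℤ) - j = ((j + (2 * j - l) : ℕ) : ℤ) + 2 * ((l : ℤ) - 2 * j) := by
          push_cast [Nat.cast_sub hl2]; ring
        rw [this, Int.negOnePow_add, Int.negOnePow_two_mul, mul_one, ← pow_add, Int.negOnePow_def, zpow_natCast]
        simp
      rw [e3]
      simp only [smul_eq_mul, nsmul_eq_mul, mul_one]
      ring
  rw [h2]
  simp only [Pi.zero_apply] at h1
  rw [h1, mul_zero]

lemma mz_a_eq (m n j : ℕ) (hj : j ≤ n) :
    ∑ k ∈ Finset.Icc (-(n : ℤ)) (n : ℤ), (((k.negOnePow : ℤ) * k ^ (2 * m) : ℤ) : ℝ) *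
      mzc ((n : ℤ) + k).toNat ((n : ℤ) - k).toNat (n - j) =
    ((∑ k ∈ Finset.Icc (-(j : ℤ)) (j : ℤ),
            (k.negOnePow : ℤ) * k ^ (2 * m) *
              (Nat.choose (2 * j) ((j : ℤ) - k).toNat : ℤ) : ℤ) : ℝ) := by
  rw [Int.cast_sum]
  rw [← Finset.sum_subset (s₁ := Finset.Icc (-(j : ℤ)) (j : ℤ))
    (by intro x; simp only [Finset.mem_Icc]; omega)]
  · refine Finset.sum_congr rfl fun k hk => ?_
    simp only [Finset.mem_Icc] at hk
    have h1 : n - j ≤ ((n : ℤ) + k).toNat ∧ n - j ≤ ((n : ℤ) - k).toNat := by omega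
    have h2 : ((n : ℤ) + k).toNat + ((n : ℤ) - k).toNat - 2 * (n - j) = 2 * j := by omega
    have h3 : ((n : ℤ) + k).toNat - (n - j) = 2 * j - ((j : ℤ) - k).toNat := by omega
    rw [mzc, if_pos h1, h2, h3, Nat.choose_symm (by omega)]
    push_cast
    ring
  · intro k hk hk'
    simp only [Finset.mem_Icc] at hk hk'
    have h1 : ¬ (n - j ≤ ((n : ℤ) + k).toNat ∧ n - j ≤ ((n : ℤ) - k).toNat) := by omega
    rw [mzc, if_neg h1, mul_zero]

/-- For positive integers `n ≥ m`:
`∑_{k=−n}^{n} (−1)^k k^(2m) π^(4n) / ((2n+2k+1)!(2n−2k+1)!)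
  = ∑_{j=1}^{m} 4^(n−j) ⬝ a_{2m,j} ⬝ ζ({2}^(2j) ⧢ {3,1}^(n−j))`,
where `a_{2m,j} = ∑_{k=−j}^{j} (−1)^k k^(2m) C(2j, j−k)`. -/
theorem zeta_shuffle_recursion_even (m n : ℕ) (hm : 0 < m) (hmn : m ≤ n) :
    ∑ k ∈ Finset.Icc (-(n : ℤ)) (n : ℤ),
      (((k.negOnePow : ℤ) * k ^ (2 * m) : ℤ) : ℝ) * Real.pi ^ (4 * n) /
        ((Nat.factorial (2 * (n : ℤ) + 2 * k + 1).toNat) *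
          (Nat.factorial (2 * (n : ℤ) - 2 * k + 1).toNat))
    = ∑ j ∈ Finset.Icc 1 m,
        (4 : ℝ) ^ (n - j) *
          ((∑ k ∈ Finset.Icc (-(j : ℤ)) (j : ℤ),
            (k.negOnePow : ℤ) * k ^ (2 * m) *
              (Nat.choose (2 * j) ((j : ℤ) - k).toNat : ℤ) : ℤ) : ℝ) *
          zetaShuffle (List.replicate (2 * j) 2)
            (List.flatten (List.replicate (n - j) [3, 1])) := by
  have h1 : ∀ k ∈ Finset.Icc (-(n : ℤ)) (n : ℤ),
      (((k.negOnePow : ℤ) * k ^ (2 * m) : ℤ) : ℝ) * Real.pi ^ (4 * n) /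
        ((Nat.factorial (2 * (n : ℤ) + 2 * k + 1).toNat) *
          (Nat.factorial (2 * (n : ℤ) - 2 * k + 1).toNat)) =
      ∑ j ∈ Finset.range (n + 1), (4 : ℝ) ^ (n - j) *
        ((((k.negOnePow : ℤ) * k ^ (2 * m) : ℤ) : ℝ) *
          mzc ((n : ℤ) + k).toNat ((n : ℤ) - k).toNat (n - j)) *
        zetaShuffle (List.replicate (2 * j) 2) (List.flatten (List.replicate (n - j) [3, 1])) := by
    intro k hk
    simp only [Finset.mem_Icc] at hk
    have hp := mz_product n ((n : ℤ) + k).toNat ((n : ℤ) - k).toNat (by omega)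
    have e1 : (2 * (n : ℤ) + 2 * k + 1).toNat = 2 * ((n : ℤ) + k).toNat + 1 := by omega
    have e2 : (2 * (n : ℤ) - 2 * k + 1).toNat = 2 * ((n : ℤ) - k).toNat + 1 := by omega
    have e3 : 4 * n = 2 * ((n : ℤ) + k).toNat + 2 * ((n : ℤ) - k).toNat := by omega
    rw [e1, e2, e3, pow_add, mul_div_assoc, mul_div_mul_comm, hp, Finset.mul_sum]
    refine Finset.sum_congr rfl fun j _ => ?_
    ring
  rw [Finset.sum_congr rfl h1, Finset.sum_comm]
  have h2 : ∀ j ∈ Finset.range (n + 1), ∑ k ∈ Finset.Icc (-(n : ℤ)) (n : ℤ), (4 : ℝ) ^ (n - j) *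
        ((((k.negOnePow : ℤ) * k ^ (2 * m) : ℤ) : ℝ) *
          mzc ((n : ℤ) + k).toNat ((n : ℤ) - k).toNat (n - j)) *
        zetaShuffle (List.replicate (2 * j) 2) (List.flatten (List.replicate (n - j) [3, 1])) =
      (4 : ℝ) ^ (n - j) *
          ((∑ k ∈ Finset.Icc (-(j : ℤ)) (j : ℤ),
            (k.negOnePow : ℤ) * k ^ (2 * m) *
              (Nat.choose (2 * j) ((j : ℤ) - k).toNat : ℤ) : ℤ) : ℝ) *
          zetaShuffle (List.replicate (2 * j) 2)
            (List.flatten (List.replicate (n - j) [3, 1])) := by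
    intro j hj
    rw [← mz_a_eq m n j (by simp at hj; omega), Finset.mul_sum, Finset.sum_mul]
  rw [Finset.sum_congr rfl h2]
  symm
  refine Finset.sum_subset (by intro x; simp only [Finset.mem_Icc, Finset.mem_range]; omega) ?_
  intro j _ hj
  simp only [Finset.mem_Icc] at hj
  have hj' : j = 0 ∨ m < j := by omega
  rcases hj' with rfl | hj'
  · have h0 : 2 * m ≠ 0 := by omega
    simp [h0]
  · rw [mz_a_zero m j hj']
    simp
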